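/- Let (X,μ) be a σ-finite measure space and f : X → ℝ⁺ a measurable function with ‖f‖_{L¹(μ)} < ∞. Then for every t > 0, ∫ₜ^∞ f*(s) ds + t·f*(t) = ∫₀^{f*(t)} λ_f(s) ds. -/

import Mathlib

open MeasureTheory ENNReal

/-- The distribution function `λ_f(s) = μ({x : |f(x)| > s})`. -/
noncomputable def distFn {α : Type*} [MeasurableSpace α] (μ : Measure α) (f : α → ℝ)
    (s : ℝ) : ℝ≥0∞ :=
  μ {x | s < |f x|}

/-- The nonincreasing rearrangement `f*(t) = inf{s > 0 : λ_f(s) ≤ t}` (with value `∞` if no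
such `s` exists). -/
noncomputable def rearr {α : Type*} [MeasurableSpace α] (μ : Measure α) (f : α → ℝ)
    (t : ℝ) : ℝ≥0∞ :=
  sInf (ENNReal.ofReal '' {s : ℝ | 0 < s ∧ distFn μ f s ≤ ENNReal.ofReal t})

theorem antitone_distFn {α : Type*} [MeasurableSpace α] (μ : Measure α) (f : α → ℝ) :
    Antitone (distFn μ f) :=
  fun _ _ h => measure_mono fun _ hx => lt_of_le_of_lt h hx

/-- The distribution function is right continuous. -/
theorem exists_gt_of_lt_distFn {α : Type*} [MeasurableSpace α] {μ : Measure α} {f : α → ℝ}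
    {r : ℝ} {a : ℝ≥0∞} (h : a < distFn μ f r) : ∃ r', r < r' ∧ a < distFn μ f r' := by
  have hU : {x | r < |f x|} = ⋃ n : ℕ, {x | r + 1 / ((n : ℝ) + 1) < |f x|} := by
    ext x
    simp only [Set.mem_ofPred_eq, Set.mem_iUnion]
    constructor
    · intro hx
      obtain ⟨n, hn⟩ := exists_nat_one_div_lt (sub_pos.2 hx)
      exact ⟨n, by linarith⟩
    · rintro ⟨n, hn⟩
      have : (0 : ℝ) < 1 / ((n : ℝ) + 1) := by positivity
      linarith
  have hmono : Monotone fun n : ℕ => {x | r + 1 / ((n : ℝ) + 1) < |f x|} := by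
    intro m n hmn x hx
    have := Nat.one_div_le_one_div (α := ℝ) hmn
    simp only [Set.mem_ofPred_eq] at hx ⊢
    linarith
  rw [distFn, hU, hmono.measure_iUnion, lt_iSup_iff] at h
  obtain ⟨n, hn⟩ := h
  exact ⟨_, lt_add_of_pos_right r (by positivity), hn⟩

theorem ofReal_lt_rearr_iff {α : Type*} [MeasurableSpace α] {μ : Measure α} {f : α → ℝ}
    {r t : ℝ} (hr : 0 < r) :
    ENNReal.ofReal r < rearr μ f t ↔ ENNReal.ofReal t < distFn μ f r := by
  constructor
  · intro h
    by_contra! hle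
    exact h.not_ge (sInf_le ⟨r, ⟨hr, hle⟩, rfl⟩)
  · intro h
    obtain ⟨r', hrr', hr'⟩ := exists_gt_of_lt_distFn h
    refine ((ENNReal.ofReal_lt_ofReal_iff (hr.trans hrr')).2 hrr').trans_le (le_sInf ?_)
    rintro _ ⟨s, ⟨-, hs⟩, rfl⟩
    refine ENNReal.ofReal_le_ofReal (le_of_not_gt fun hlt => ?_)
    exact hr'.not_ge ((antitone_distFn μ f hlt.le).trans hs)

theorem rearr_ne_top {α : Type*} [MeasurableSpace α] {μ : Measure α} {f : α → ℝ}
    (hf : Measurable f) (hL1 : ∫⁻ x, ENNReal.ofReal |f x| ∂μ ≠ ⊤) {t : ℝ} (ht : 0 < t) :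
    rearr μ f t ≠ ⊤ := by
  set C := ∫⁻ x, ENNReal.ofReal |f x| ∂μ
  have hs : 0 < (C.toReal + 1) / t := by positivity
  refine ne_top_of_le_ne_top (ENNReal.ofReal_ne_top (r := (C.toReal + 1) / t))
    (sInf_le ⟨_, ⟨hs, ?_⟩, rfl⟩)
  have hmarkov : distFn μ f ((C.toReal + 1) / t) ≤ C / ENNReal.ofReal ((C.toReal + 1) / t) := by
    refine (measure_mono fun x hx => ?_).trans (meas_ge_le_lintegral_div
      hf.norm.ennreal_ofReal.aemeasurable (by simpa using hs) ENNReal.ofReal_ne_top)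
    exact ENNReal.ofReal_le_ofReal (le_of_lt hx)
  refine hmarkov.trans (ENNReal.div_le_of_le_mul ?_)
  rw [← ENNReal.ofReal_mul ht.le, mul_div_cancel₀ _ ht.ne']
  exact (ENNReal.le_ofReal_iff_toReal_le hL1 (by positivity)).2 (by linarith)

theorem volume_Ioi_inter_ofReal_lt {t : ℝ} (ht : 0 ≤ t) (a : ℝ≥0∞) :
    volume ({s | ENNReal.ofReal s < a} ∩ Set.Ioi t) = a - ENNReal.ofReal t := by
  induction a using ENNReal.recTopCoe with
  | top => simp
  | coe a =>
    have : {s | ENNReal.ofReal s < (a : ℝ≥0∞)} ∩ Set.Ioi t = Set.Ioo t a := by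
      ext s
      simp only [Set.mem_inter_iff, Set.mem_ofPred_eq, Set.mem_Ioi, Set.mem_Ioo]
      rw [and_comm]
      refine and_congr_right fun hs => ?_
      rw [ENNReal.ofReal_lt_iff_lt_toReal (ht.trans hs.le) ENNReal.coe_ne_top,
        ENNReal.coe_toReal]
    rw [this, Real.volume_Ioo, ENNReal.ofReal_sub _ ht, ENNReal.ofReal_coe_nnreal]

theorem lintegral_Ioi_rearr {α : Type*} [MeasurableSpace α] (μ : Measure α) (f : α → ℝ)
    {t : ℝ} (ht : 0 ≤ t) :
    ∫⁻ s in Set.Ioi t, rearr μ f s =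
      ∫⁻ r in Set.Ioi (0 : ℝ), (distFn μ f r - ENNReal.ofReal t) := by
  have hmeas : Measurable (distFn μ f) := (antitone_distFn μ f).measurable
  let A : Set (ℝ × ℝ) := {p | ENNReal.ofReal p.1 < distFn μ f p.2}
  have hA : MeasurableSet A :=
    measurableSet_lt (ENNReal.measurable_ofReal.comp measurable_fst) (hmeas.comp measurable_snd)
  calc ∫⁻ s in Set.Ioi t, rearr μ f s
      = ∫⁻ s in Set.Ioi t, ∫⁻ r in Set.Ioi (0 : ℝ), A.indicator 1 (s, r) := by
        refine lintegral_congr fun s => ?_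
        have hsec : MeasurableSet {r | (s, r) ∈ A} := hA.preimage measurable_prodMk_left
        have : ∀ r, A.indicator (1 : ℝ × ℝ → ℝ≥0∞) (s, r) =
            {r | (s, r) ∈ A}.indicator 1 r := fun r => rfl
        simp_rw [this]
        rw [lintegral_indicator_one hsec, Measure.restrict_apply hsec]
        have heq : {r | (s, r) ∈ A} ∩ Set.Ioi 0 =
            {r | ENNReal.ofReal r < rearr μ f s} ∩ Set.Ioi 0 := by
          ext r
          exact and_congr_left fun hr => (ofReal_lt_rearr_iff hr).symm
        rw [heq, volume_Ioi_inter_ofReal_lt le_rfl]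
        simp
    _ = ∫⁻ r in Set.Ioi (0 : ℝ), ∫⁻ s in Set.Ioi t, A.indicator 1 (s, r) :=
        lintegral_lintegral_swap (measurable_one.indicator hA).aemeasurable
    _ = _ := by
        refine lintegral_congr fun r => ?_
        have hsec : MeasurableSet {s | (s, r) ∈ A} := hA.preimage measurable_prodMk_right
        have : ∀ s, A.indicator (1 : ℝ × ℝ → ℝ≥0∞) (s, r) =
            {s | (s, r) ∈ A}.indicator 1 s := fun s => rfl
        simp_rw [this]
        rw [lintegral_indicator_one hsec, Measure.restrict_apply hsec]
        exact volume_Ioi_inter_ofReal_lt ht (distFn μ f r)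

/-- For a nonnegative integrable `f`, for every `t > 0`,
`∫ₜ^∞ f*(s) ds + t·f*(t) = ∫₀^{f*(t)} λ_f(s) ds`. -/
theorem rearr_lambda_identity {X : Type*} [MeasurableSpace X] (μ : Measure X) [SigmaFinite μ]
    (f : X → ℝ) (hf : Measurable f) (hf0 : ∀ x, 0 ≤ f x)
    (hL1 : ∫⁻ x, ENNReal.ofReal (f x) ∂μ < ⊤) :
    ∀ t : ℝ, 0 < t →
      (∫⁻ s in Set.Ioi t, rearr μ f s) + ENNReal.ofReal t * rearr μ f t =
        ∫⁻ s in Set.Ioo 0 ((rearr μ f t).toReal), distFn μ f s := by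
  intro t ht
  have hfin : rearr μ f t ≠ ⊤ :=
    rearr_ne_top hf (by simpa only [abs_of_nonneg (hf0 _)] using hL1.ne) ht
  have hmem : ∀ r : ℝ, 0 < r →
      (r < (rearr μ f t).toReal ↔ ENNReal.ofReal t < distFn μ f r) := fun r hr => by
    rw [← ofReal_lt_rearr_iff hr, ENNReal.ofReal_lt_iff_lt_toReal hr.le hfin]
  have hcut : ∫⁻ r in Set.Ioi (0 : ℝ), (distFn μ f r - ENNReal.ofReal t) =
      ∫⁻ r in Set.Ioo 0 (rearr μ f t).toReal, (distFn μ f r - ENNReal.ofReal t) := by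
    rw [← lintegral_inter_add_sdiff _ (Set.Ioi 0) (measurableSet_Ioo (a := 0)
      (b := (rearr μ f t).toReal)), Set.inter_eq_right.2 Set.Ioo_subset_Ioi_self,
      setLIntegral_eq_zero (measurableSet_Ioi.diff measurableSet_Ioo), add_zero]
    exact fun r hr => tsub_eq_zero_of_le
      (le_of_not_gt fun hlt => hr.2 ⟨hr.1, (hmem r hr.1).2 hlt⟩)
  have hconst : ENNReal.ofReal t * rearr μ f t =
      ∫⁻ _ in Set.Ioo 0 (rearr μ f t).toReal, ENNReal.ofReal t := by
    rw [setLIntegral_const, Real.volume_Ioo, sub_zero, ENNReal.ofReal_toReal hfin]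
  rw [lintegral_Ioi_rearr μ f ht.le, hcut, hconst, ← lintegral_add_right _ measurable_const]
  exact setLIntegral_congr_fun measurableSet_Ioo fun r hr =>
    tsub_add_cancel_of_le ((hmem r hr.1).1 hr.2).le
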